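/- arXiv:1701.00665 — 3 statements merged into one kernel-verified Lean document; each statement's English description precedes it below -/
import Mathlib

section
/- Let X be a monoid, G a group, f : X →* G a monoid homomorphism, and s : G →* X a monoid homomorphism with f (s y) = y for all y ∈ G. If N is a submonoid of X that contains every x ∈ X with f x = 1 and contains s y for every y ∈ G, then N = ⊤ (i.e. N is all of X); in other words, the join of the kernel of f and the range of s is the whole of X. -/
/-- Every split extension of monoids over a group is strong: if `f : X →* G` is a
monoid homomorphism onto a group `G` with section `s`, then any submonoid of `X`
containing the kernel of `f` and the range of `s` is all of `X`. -/
theorem splitExtension_over_group_join_decomposition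
    {X G : Type*} [Monoid X] [Group G] (f : X →* G) (s : G →* X)
    (hfs : ∀ y : G, f (s y) = y) (N : Submonoid X)
    (hker : ∀ x : X, f x = 1 → x ∈ N) (hrange : ∀ y : G, s y ∈ N) :
    N = ⊤ := by
  refine (Submonoid.eq_top_iff' N).2 fun x => ?_
  have hk : x * s (f x)⁻¹ ∈ N := hker _ (by rw [map_mul, hfs, mul_inv_cancel])
  have hx : x * s (f x)⁻¹ * s (f x) = x := by
    rw [mul_assoc, ← map_mul, inv_mul_cancel, map_one, mul_one]
  exact hx ▸ N.mul_mem hk (hrange (f x))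
end

section
/- Let X and W be monoids, G a group, f : X →* G and g : W →* G monoid homomorphisms, and s : G →* X a monoid homomorphism with f (s y) = y for all y ∈ G. Let N be a submonoid of the product monoid W × X that contains every pair (1, x') with f x' = 1 and contains the pair (w', s (g w')) for every w' ∈ W. Then for every pair (w, x) ∈ W × X with g w = f x, the pair (w, x) belongs to N. In particular, every element (w, x) of the pullback {(w, x) ∈ W × X ∣ g w = f x} decomposes as (w, x) = (1, x * s((g w)⁻¹)) * (w, s (g w)), where the first factor lies in the kernel of the first projection restricted to the pullback. -/
/-- Every split extension of monoids over a group is stably strong: given a split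
epimorphism of monoids `f : X →* G` with section `s` onto a group `G` and any monoid
homomorphism `g : W →* G`, every submonoid `N` of `W × X` containing the kernel of the
first projection of the pullback and the image of the induced section `w ↦ (w, s (g w))`
contains the whole pullback `{(w, x) | g w = f x}`; indeed each such `(w, x)` decomposes
as `(1, x * s((g w)⁻¹)) * (w, s (g w))`. -/
theorem pullback_of_splitExtension_over_group_join_decomposition
    {X W G : Type*} [Monoid X] [Monoid W] [Group G]
    (f : X →* G) (g : W →* G) (s : G →* X) (hfs : ∀ y : G, f (s y) = y)
    (N : Submonoid (W × X))
    (hker : ∀ x' : X, f x' = 1 → ((1 : W), x') ∈ N)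
    (hsec : ∀ w' : W, (w', s (g w')) ∈ N) :
    ∀ w : W, ∀ x : X, g w = f x →
      (w, x) ∈ N ∧
        (w, x) = ((1 : W), x * s ((g w)⁻¹)) * (w, s (g w)) := by
  intro w x hwx
  have hdecomp : (w, x) = ((1 : W), x * s ((g w)⁻¹)) * (w, s (g w)) := by
    rw [Prod.mk_mul_mk, one_mul, mul_assoc, ← map_mul, inv_mul_cancel, map_one, mul_one]
  refine ⟨?_, hdecomp⟩
  rw [hdecomp]
  exact N.mul_mem (hker _ (by rw [map_mul, hfs, hwx, mul_inv_cancel])) (hsec w)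
end

section
/- Let K be a field and let X, Y, Z be K-coalgebras, and equip X ⊗[K] Y with the tensor product coalgebra structure. Let h, h' : Z → X ⊗[K] Y be two morphisms of K-coalgebras. If the composites of h and h' with id_X ⊗ counit_Y : X ⊗[K] Y → X ⊗[K] K are equal, and the composites of h and h' with counit_X ⊗ id_Y : X ⊗[K] Y → K ⊗[K] Y are equal, then h = h'. In other words, the pair of linear maps (id_X ⊗ counit_Y, counit_X ⊗ id_Y) out of X ⊗[K] Y is jointly monomorphic on coalgebra morphisms. -/
open scoped TensorProduct

open Coalgebra

universe u

/-- Applying `id ⊗ counit` and `counit ⊗ id` to the two legs of the comultiplication of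
`X ⊗[K] Y` recovers the original element. -/
theorem map_rid_lid_comul_tensor
    {K X Y : Type*} [CommSemiring K] [AddCommMonoid X] [AddCommMonoid Y]
    [Module K X] [Module K Y] [Coalgebra K X] [Coalgebra K Y] (t : X ⊗[K] Y) :
    TensorProduct.map
      ((TensorProduct.rid K X).toLinearMap ∘ₗ
        TensorProduct.map LinearMap.id (counit (R := K) (A := Y)))
      ((TensorProduct.lid K Y).toLinearMap ∘ₗ
        TensorProduct.map (counit (R := K) (A := X)) LinearMap.id)
      (comul (R := K) t) = t := by
  have key (a : X ⊗[K] X) (b : Y ⊗[K] Y) :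
      TensorProduct.map
        ((TensorProduct.rid K X).toLinearMap ∘ₗ
          TensorProduct.map LinearMap.id (counit (R := K) (A := Y)))
        ((TensorProduct.lid K Y).toLinearMap ∘ₗ
          TensorProduct.map (counit (R := K) (A := X)) LinearMap.id)
        (TensorProduct.AlgebraTensorModule.tensorTensorTensorComm K K K K X X Y Y
          (a ⊗ₜ[K] b)) =
      TensorProduct.rid K X ((counit (R := K) (A := X)).lTensor X a) ⊗ₜ[K]
        TensorProduct.lid K Y ((counit (R := K) (A := Y)).rTensor Y b) := by
    induction a with
    | zero => simp only [TensorProduct.zero_tmul, map_zero]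
    | add a₁ a₂ h₁ h₂ => simp only [TensorProduct.add_tmul, map_add, h₁, h₂]
    | tmul x₁ x₂ =>
      induction b with
      | zero => simp only [TensorProduct.tmul_zero, map_zero]
      | add b₁ b₂ h₁ h₂ => simp only [TensorProduct.tmul_add, map_add, h₁, h₂]
      | tmul y₁ y₂ =>
        simp [TensorProduct.smul_tmul', TensorProduct.tmul_smul, smul_smul, mul_comm]
  induction t with
  | zero => simp only [map_zero]
  | add t₁ t₂ h₁ h₂ => simp only [map_add, h₁, h₂]
  | tmul x y =>
    rw [TensorProduct.comul_tmul, key, lTensor_counit_comul, rTensor_counit_comul]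
    simp

/-- The pair of linear maps `(id ⊗ counit, counit ⊗ id)` out of a tensor product of
coalgebras `X ⊗[K] Y` is jointly monomorphic on coalgebra morphisms: two coalgebra
morphisms `h, h' : Z → X ⊗[K] Y` having equal composites with both maps are equal. -/
theorem coalgHom_into_tensor_ext
    {K : Type u} [Field K] {X Y Z : Type u}
    [AddCommGroup X] [AddCommGroup Y] [AddCommGroup Z]
    [Module K X] [Module K Y] [Module K Z]
    [Coalgebra K X] [Coalgebra K Y] [Coalgebra K Z]
    (h h' : Z →ₗc[K] X ⊗[K] Y)
    (h₁ : TensorProduct.map LinearMap.id (counit (R := K) (A := Y)) ∘ₗ h.toLinearMap =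
      TensorProduct.map LinearMap.id (counit (R := K) (A := Y)) ∘ₗ h'.toLinearMap)
    (h₂ : TensorProduct.map (counit (R := K) (A := X)) LinearMap.id ∘ₗ h.toLinearMap =
      TensorProduct.map (counit (R := K) (A := X)) LinearMap.id ∘ₗ h'.toLinearMap) :
    h = h' := by
  ext z
  rw [← map_rid_lid_comul_tensor (h z), ← map_rid_lid_comul_tensor (h' z),
    ← CoalgHomClass.map_comp_comul_apply, ← CoalgHomClass.map_comp_comul_apply,
    TensorProduct.map_map, TensorProduct.map_map, LinearMap.comp_assoc, LinearMap.comp_assoc,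
    LinearMap.comp_assoc, LinearMap.comp_assoc]
  exact DFunLike.congr_fun (congrArg₂ (fun f g ↦ TensorProduct.map
    ((TensorProduct.rid K X).toLinearMap ∘ₗ f) ((TensorProduct.lid K Y).toLinearMap ∘ₗ g))
    h₁ h₂) (comul z)
end
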